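/- Let n ≥ 1, m ≥ 1, p > 1, and let u = (u_1,…,u_m) be a C² stable solution of −Δu_i = |u|^{p−1} u_i on ℝⁿ. Then there is a constant C > 0, independent of R, such that for every R > 1: ∫_{B_R} |u|^{p+1} dx ≤ C R^{n − 2(p+1)/(p−1)} and Σ_i ∫_{B_R} |∇u_i|² dx ≤ C R^{n − 2(p+1)/(p−1)}, where B_R is the ball of radius R centered at the origin. -/

import Mathlib

open MeasureTheory Metric Filter Real Set

noncomputable section

/-- `n`-dimensional Euclidean space. -/
abbrev Euc (n : ℕ) := EuclideanSpace ℝ (Fin n)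

/-- Laplacian of a scalar function on Euclidean space. -/
def lap {n : ℕ} (f : Euc n → ℝ) (x : Euc n) : ℝ :=
  ∑ i : Fin n, iteratedFDeriv ℝ 2 f x ![EuclideanSpace.single i 1, EuclideanSpace.single i 1]

/-- Stability (quadratic form) inequality for the second order Lane–Emden system, tested
against families of smooth compactly supported functions whose supports lie in `S`:
`Σ_i ∫ |u|^{p−1} φ_i² + (p−1) Σ_{i,j} ∫ |u|^{p−3} u_i u_j φ_i φ_j ≤ Σ_i ∫ |∇φ_i|²`.
(Since `‖u x‖ ^ (p−3)` is interpreted with `Real.rpow`, the term `|u|^{p−3} u_i u_j`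
vanishes on the set where `u = 0`, for any `p > 1`.) -/
def Stable1 (n m : ℕ) (p : ℝ) (u : Euc n → EuclideanSpace ℝ (Fin m))
    (S : Set (Euc n)) : Prop :=
  ∀ φ : Fin m → Euc n → ℝ,
    (∀ i, ContDiff ℝ (⊤ : ℕ∞) (φ i)) → (∀ i, HasCompactSupport (φ i)) →
    (∀ i, tsupport (φ i) ⊆ S) →
    (∑ i, ∫ x, ‖u x‖ ^ (p - 1) * (φ i x) ^ 2) +
      (p - 1) * ∑ i, ∑ j, ∫ x, ‖u x‖ ^ (p - 3) * u x i * u x j * φ i x * φ j x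
      ≤ ∑ i, ∫ x, ‖gradient (φ i) x‖ ^ 2

section Approximation

open scoped Topology Convolution Pointwise

lemma norm_gradient_eq {n : ℕ} (f : Euc n → ℝ) (x : Euc n) :
    ‖gradient f x‖ = ‖fderiv ℝ f x‖ := by
  rw [gradient, LinearIsometryEquiv.norm_map]

/-- A sequence of mollifications approximates a `C¹` compactly supported function in `C¹`,
with uniform bounds and supports in a common compact set. -/
lemma exists_smooth_approx {n : ℕ} {g : Euc n → ℝ} (hg : ContDiff ℝ 1 g)
    (hc : HasCompactSupport g) :
    ∃ G : ℕ → Euc n → ℝ, (∀ k, ContDiff ℝ (⊤ : ℕ∞) (G k)) ∧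
      ∃ K : Set (Euc n), IsCompact K ∧ (∀ k, tsupport (G k) ⊆ K) ∧
      ∃ M : ℝ, (∀ k x, ‖G k x‖ ≤ M) ∧ (∀ k x, ‖fderiv ℝ (G k) x‖ ≤ M) ∧
        (∀ x, Tendsto (fun k => G k x) atTop (𝓝 (g x))) ∧
        ∀ x, Tendsto (fun k => fderiv ℝ (G k) x) atTop (𝓝 (fderiv ℝ g x)) := by
  let ρ : ℕ → ContDiffBump (0 : Euc n) := fun k =>
    ⟨1 / (2 * ((k : ℝ) + 1)), 1 / ((k : ℝ) + 1), by positivity, by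
      apply one_div_lt_one_div_of_lt <;> linarith [(Nat.cast_nonneg k : (0 : ℝ) ≤ k)]⟩
  have hρ0 : Tendsto (fun k => (ρ k).rOut) atTop (𝓝 0) :=
    tendsto_one_div_add_atTop_nhds_zero_nat
  have hρ1 : ∀ k, (ρ k).rOut ≤ 1 := fun k => by
    change 1 / ((k : ℝ) + 1) ≤ 1
    rw [div_le_one (by positivity)]
    linarith [(Nat.cast_nonneg k : (0 : ℝ) ≤ k)]
  have hloc : ∀ k, LocallyIntegrable ((ρ k).normed volume) volume := fun k =>
    (ρ k).continuous_normed.locallyIntegrable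
  have hg' : Continuous (fderiv ℝ g) := hg.continuous_fderiv one_ne_zero
  have hfd : ∀ k x, fderiv ℝ ((ρ k).normed volume ⋆[ContinuousLinearMap.lsmul ℝ ℝ, volume] g) x
      = ((ρ k).normed volume ⋆[ContinuousLinearMap.lsmul ℝ ℝ, volume] fderiv ℝ g) x :=
    fun k x => (hc.hasFDerivAt_convolution_right (ContinuousLinearMap.lsmul ℝ ℝ)
      (hloc k) hg x).fderiv
  have hbd : ∀ {F : Type} [NormedAddCommGroup F] [NormedSpace ℝ F] [CompleteSpace F]
      (h : Euc n → F), Continuous h → HasCompactSupport h → ∃ M, ∀ k x,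
      ‖((ρ k).normed volume ⋆[ContinuousLinearMap.lsmul ℝ ℝ, volume] h) x‖ ≤ M := by
    intro F _ _ _ h hh hhc
    obtain ⟨M, hM⟩ := hhc.exists_bound_of_continuous hh
    refine ⟨3 * M, fun k x => ?_⟩
    have := (ρ k).dist_normed_convolution_le (μ := volume) (g := h) (x₀ := x) (ε := 2 * M)
      hh.aestronglyMeasurable (fun y _ => by
        rw [dist_eq_norm]; linarith [norm_sub_le (h y) (h x), hM x, hM y])
    rw [dist_eq_norm] at this
    have h2 := norm_le_norm_add_norm_sub'
      (((ρ k).normed volume ⋆[ContinuousLinearMap.lsmul ℝ ℝ, volume] h) x) (h x)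
    linarith [hM x]
  obtain ⟨M₁, hM₁⟩ := hbd g hg.continuous hc
  obtain ⟨M₂, hM₂⟩ := hbd (fderiv ℝ g) hg' (hc.fderiv ℝ)
  refine ⟨fun k => (ρ k).normed volume ⋆[ContinuousLinearMap.lsmul ℝ ℝ, volume] g, fun k => ?_,
    closedBall 0 1 + tsupport g, (isCompact_closedBall _ _).add hc, fun k => ?_, max M₁ M₂,
    fun k x => (hM₁ k x).trans (le_max_left _ _), fun k x => ?_, fun x => ?_, fun x => ?_⟩
  · exact (ρ k).hasCompactSupport_normed.contDiff_convolution_left _ (ρ k).contDiff_normed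
      hg.continuous.locallyIntegrable
  · refine closure_minimal ?_ ((isCompact_closedBall _ _).add hc).isClosed
    refine (support_convolution_subset _).trans (Set.add_subset_add ?_ (subset_tsupport g))
    rw [(ρ k).support_normed_eq]
    exact ball_subset_closedBall.trans (closedBall_subset_closedBall (hρ1 k))
  · rw [hfd]
    exact (hM₂ k x).trans (le_max_right _ _)
  · exact ContDiffBump.convolution_tendsto_right_of_continuous hρ0 hg.continuous x
  · simp_rw [hfd]
    exact ContDiffBump.convolution_tendsto_right_of_continuous hρ0 hg' x

/-- Dominated convergence against a locally integrable weight. -/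
lemma tendsto_integral_mul_of_bounded_of_support {n : ℕ} {w : Euc n → ℝ}
    (hw : LocallyIntegrable w volume) {f : ℕ → Euc n → ℝ} {f₀ : Euc n → ℝ}
    (hf : ∀ k, Continuous (f k)) {K : Set (Euc n)} (hK : IsCompact K)
    (hsupp : ∀ k, ∀ x ∉ K, f k x = 0) {M : ℝ} (hM : ∀ k x, ‖f k x‖ ≤ M)
    (hlim : ∀ x, Tendsto (fun k => f k x) atTop (𝓝 (f₀ x))) :
    Tendsto (fun k => ∫ x, w x * f k x) atTop (𝓝 (∫ x, w x * f₀ x)) := by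
  refine tendsto_integral_of_dominated_convergence (K.indicator fun x => ‖w x‖ * M)
    (fun k => hw.aestronglyMeasurable.mul (hf k).aestronglyMeasurable) ?_ (fun k => ?_) ?_
  · rw [integrable_indicator_iff hK.measurableSet]
    exact ((hw.integrableOn_isCompact hK).norm).mul_const M
  · refine Eventually.of_forall fun x => ?_
    by_cases hx : x ∈ K
    · rw [Set.indicator_of_mem hx, norm_mul]
      exact mul_le_mul_of_nonneg_left (hM k x) (norm_nonneg _)
    · simp [Set.indicator_of_notMem hx, hsupp k x hx]
  · exact Eventually.of_forall fun x => (hlim x).const_mul _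

lemma abs_rpow_sub_mul_coord_mul_coord_le {m : ℕ} (p : ℝ) (v : EuclideanSpace ℝ (Fin m))
    (i j : Fin m) : |‖v‖ ^ (p - 3) * v i * v j| ≤ ‖v‖ ^ (p - 1) := by
  rcases eq_or_ne v 0 with rfl | hv
  · simpa using Real.rpow_nonneg le_rfl _
  · have h0 : 0 < ‖v‖ := norm_pos_iff.2 hv
    have e : ‖v‖ ^ (p - 1) = ‖v‖ ^ (p - 3) * ‖v‖ * ‖v‖ := by
      rw [show p - 1 = p - 3 + 1 + 1 by ring, Real.rpow_add_one h0.ne', Real.rpow_add_one h0.ne']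
    have hi : |v i| ≤ ‖v‖ := by simpa using PiLp.norm_apply_le v i
    have hj : |v j| ≤ ‖v‖ := by simpa using PiLp.norm_apply_le v j
    rw [e, abs_mul, abs_mul, abs_of_nonneg (Real.rpow_nonneg h0.le _)]
    gcongr

/-- The stability inequality extends from smooth to `C¹` test functions. -/
lemma Stable1.of_contDiff_one {n m : ℕ} {p : ℝ} (hp : 1 < p)
    {u : Euc n → EuclideanSpace ℝ (Fin m)} (hu : Continuous u)
    (hstab : Stable1 n m p u Set.univ) {φ : Fin m → Euc n → ℝ}
    (hφ : ∀ i, ContDiff ℝ 1 (φ i)) (hc : ∀ i, HasCompactSupport (φ i)) :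
    (∑ i, ∫ x, ‖u x‖ ^ (p - 1) * (φ i x) ^ 2) +
      (p - 1) * ∑ i, ∑ j, ∫ x, ‖u x‖ ^ (p - 3) * u x i * u x j * φ i x * φ j x
      ≤ ∑ i, ∫ x, ‖fderiv ℝ (φ i) x‖ ^ 2 := by
  choose G hG K hK hGK M hM hM' hlim hlim' using fun i => exists_smooth_approx (hφ i) (hc i)
  have hG0 : ∀ i k, ∀ x ∉ K i, G i k x = 0 := fun i k x hx =>
    image_eq_zero_of_notMem_tsupport fun h => hx (hGK i k h)
  have hG0' : ∀ i k, ∀ x ∉ K i, fderiv ℝ (G i k) x = 0 := fun i k x hx =>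
    image_eq_zero_of_notMem_tsupport fun h => hx (hGK i k (tsupport_fderiv_subset ℝ h))
  have hw : LocallyIntegrable (fun x => ‖u x‖ ^ (p - 1)) volume :=
    (hu.norm.rpow_const fun x => Or.inr (by linarith)).locallyIntegrable
  have hui : ∀ i, Continuous fun x => u x i := fun i => by fun_prop
  have hw' : ∀ i j, LocallyIntegrable (fun x => ‖u x‖ ^ (p - 3) * u x i * u x j) volume := by
    intro i j
    refine hw.mono ?_ (Eventually.of_forall fun x => ?_)
    · exact (((hu.norm.measurable.pow_const _).mul (hui i).measurable).mul
        (hui j).measurable).aestronglyMeasurable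
    · exact (abs_rpow_sub_mul_coord_mul_coord_le p (u x) i j).trans (le_abs_self _)
  have hMnn : ∀ i, 0 ≤ M i := fun i => (norm_nonneg _).trans (hM i 0 0)
  have key : ∀ k, _ := fun k => hstab (fun i => G i k) (fun i => hG i k)
    (fun i => HasCompactSupport.of_support_subset_isCompact (hK i)
      ((subset_tsupport _).trans (hGK i k))) fun i => Set.subset_univ _
  simp only [norm_gradient_eq] at key
  refine le_of_tendsto_of_tendsto' (b := atTop) (Tendsto.add (tendsto_finsetSum _ fun i _ => ?_)
    (Tendsto.const_mul _ (tendsto_finsetSum _ fun i _ => tendsto_finsetSum _ fun j _ => ?_)))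
    (tendsto_finsetSum _ fun i _ => ?_) key
  · refine tendsto_integral_mul_of_bounded_of_support (K := K i) (M := M i ^ 2) hw
      (fun k => (hG i k).continuous.pow 2) (hK i) (fun k x hx => by simp [hG0 i k x hx])
      (fun k x => ?_) fun x => (hlim i x).pow 2
    rw [norm_pow]
    exact pow_le_pow_left₀ (norm_nonneg _) (hM i k x) 2
  · simp only [mul_assoc _ (φ i _), mul_assoc _ (G i _ _)]
    refine tendsto_integral_mul_of_bounded_of_support (K := K i) (M := M i * M j) (hw' i j)
      (fun k => (hG i k).continuous.mul (hG j k).continuous) (hK i)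
      (fun k x hx => by simp [hG0 i k x hx])
      (fun k x => ?_) fun x => (hlim i x).mul (hlim j x)
    rw [norm_mul]
    exact mul_le_mul (hM i k x) (hM j k x) (norm_nonneg _) (hMnn i)
  · have := tendsto_integral_mul_of_bounded_of_support (K := K i) (M := M i ^ 2)
      (w := fun _ => (1 : ℝ)) (f := fun k x => ‖fderiv ℝ (G i k) x‖ ^ 2)
      (f₀ := fun x => ‖fderiv ℝ (φ i) x‖ ^ 2) continuous_const.locallyIntegrable
      (fun k => ((hG i k).continuous_fderiv (by simp)).norm.pow 2) (hK i)
      (fun k x hx => by simp [hG0' i k x hx])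
      (fun k x => ?_) fun x => (hlim' i x).norm.pow 2
    · simpa only [one_mul] using this
    · rw [norm_pow, norm_norm]
      exact pow_le_pow_left₀ (norm_nonneg _) (hM' i k x) 2

end Approximation

lemma norm_fderiv_sq_eq_sum {n : ℕ} (f : Euc n → ℝ) (x : Euc n) :
    ‖fderiv ℝ f x‖ ^ 2 = ∑ k : Fin n, (fderiv ℝ f x (EuclideanSpace.single k 1)) ^ 2 := by
  rw [← norm_gradient_eq, EuclideanSpace.real_norm_sq_eq]
  refine Finset.sum_congr rfl fun k _ => ?_
  rw [← toDual_gradient (𝕜 := ℝ), InnerProductSpace.toDual_apply_apply,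
    EuclideanSpace.inner_single_right]
  simp

lemma integral_sq_fderiv_mul_apply {n : ℕ} {f η : Euc n → ℝ} (hf : ContDiff ℝ 2 f)
    (hη : ContDiff ℝ 1 η) (hc : HasCompactSupport η) (e : Euc n) :
    ∫ x, (fderiv ℝ (fun y => f y * η y) x e) ^ 2 =
      -(∫ x, fderiv ℝ (fderiv ℝ f) x e e * (f x * η x ^ 2)) +
        ∫ x, f x ^ 2 * (fderiv ℝ η x e) ^ 2 := by
  have hf1 : ContDiff ℝ 1 f := hf.of_le one_le_two
  have hDf : ContDiff ℝ 1 (fderiv ℝ f) := hf.fderiv_right (by norm_num)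
  have hDfe : ContDiff ℝ 1 fun y => fderiv ℝ f y e := hDf.clm_apply contDiff_const
  have hg : ContDiff ℝ 1 fun y => f y * η y ^ 2 := hf1.mul (hη.pow 2)
  have hD2 : ∀ x, fderiv ℝ (fun y => fderiv ℝ f y e) x e = fderiv ℝ (fderiv ℝ f) x e e := by
    intro x
    rw [fderiv_clm_apply (hDf.differentiable one_ne_zero x) (differentiableAt_const e)]
    simp
  have cη := hη.continuous
  have cη' : Continuous fun x => fderiv ℝ η x e :=
    (hη.continuous_fderiv one_ne_zero).clm_apply continuous_const
  have cg' : Continuous fun x => fderiv ℝ (fun y => f y * η y ^ 2) x e :=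
    (hg.continuous_fderiv one_ne_zero).clm_apply continuous_const
  have cD2 : Continuous fun x => fderiv ℝ (fun y => fderiv ℝ f y e) x e :=
    (hDfe.continuous_fderiv one_ne_zero).clm_apply continuous_const
  have hcg : HasCompactSupport fun y => f y * η y ^ 2 :=
    hc.mono fun x hx h0 => hx (by simp [h0])
  have hcη' : HasCompactSupport fun x => fderiv ℝ η x e := hc.fderiv_apply ℝ e
  have I₁ : Integrable fun x => fderiv ℝ (fun y => fderiv ℝ f y e) x e * (f x * η x ^ 2) :=
    (cD2.mul hg.continuous).integrable_of_hasCompactSupport hcg.mul_left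
  have I₂ : Integrable fun x => fderiv ℝ f x e * fderiv ℝ (fun y => f y * η y ^ 2) x e :=
    (hDfe.continuous.mul cg').integrable_of_hasCompactSupport (hcg.fderiv_apply ℝ e).mul_left
  have I₃ : Integrable fun x => fderiv ℝ f x e * (f x * η x ^ 2) :=
    (hDfe.continuous.mul hg.continuous).integrable_of_hasCompactSupport hcg.mul_left
  have I₄ : Integrable fun x => f x ^ 2 * (fderiv ℝ η x e) ^ 2 :=
    ((hf1.continuous.pow 2).mul (cη'.pow 2)).integrable_of_hasCompactSupport
      (hcη'.mono fun x hx h0 => hx (by simp [h0]))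
  have key := integral_mul_fderiv_eq_neg_fderiv_mul_of_integrable I₁ I₂ I₃
    (fun x _ => hDfe.differentiable one_ne_zero x) fun x _ => hg.differentiable one_ne_zero x
  simp only [hD2] at key
  rw [← key, ← integral_add I₂ I₄]
  refine integral_congr_ae (Eventually.of_forall fun x => ?_)
  have df := (hf1.differentiable one_ne_zero x).hasFDerivAt
  have dη := (hη.differentiable one_ne_zero x).hasFDerivAt
  have e₁ : fderiv ℝ (fun y => f y * η y) x = _ := (df.mul dη).fderiv
  have e₂ : fderiv ℝ (fun y => f y * η y ^ 2) x = _ := (df.mul (dη.pow 2)).fderiv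
  simp only [e₁, e₂]
  simp
  ring

/-- Integration by parts: the Dirichlet energy of a localised function. -/
lemma integral_norm_fderiv_mul_sq {n : ℕ} {f η : Euc n → ℝ} (hf : ContDiff ℝ 2 f)
    (hη : ContDiff ℝ 1 η) (hc : HasCompactSupport η) :
    ∫ x, ‖fderiv ℝ (fun y => f y * η y) x‖ ^ 2 =
      (∫ x, -lap f x * f x * η x ^ 2) + ∫ x, f x ^ 2 * ‖fderiv ℝ η x‖ ^ 2 := by
  have hf1 : ContDiff ℝ 1 f := hf.of_le one_le_two
  have hDf : ContDiff ℝ 1 (fderiv ℝ f) := hf.fderiv_right (by norm_num)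
  have hfη : ContDiff ℝ 1 fun y => f y * η y := hf1.mul hη
  have hcf : HasCompactSupport fun y => f y * η y := hc.mul_left
  have hlap : ∀ x, -lap f x * f x * η x ^ 2 = ∑ k : Fin n,
      -(fderiv ℝ (fderiv ℝ f) x (EuclideanSpace.single k 1) (EuclideanSpace.single k 1) *
        (f x * η x ^ 2)) := by
    intro x
    simp only [lap, iteratedFDeriv_two_apply, Finset.sum_neg_distrib, ← Finset.sum_mul]
    simp
    ring
  simp only [hlap, norm_fderiv_sq_eq_sum, Finset.mul_sum]
  have cD (k : Fin n) : Continuous fun x =>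
      fderiv ℝ (fun y => f y * η y) x (EuclideanSpace.single k 1) :=
    (hfη.continuous_fderiv one_ne_zero).clm_apply continuous_const
  have cη' (k : Fin n) : Continuous fun x => fderiv ℝ η x (EuclideanSpace.single k 1) :=
    (hη.continuous_fderiv one_ne_zero).clm_apply continuous_const
  have cD2 (k : Fin n) : Continuous fun x => fderiv ℝ (fderiv ℝ f) x
      (EuclideanSpace.single k 1) (EuclideanSpace.single k 1) :=
    ((hDf.continuous_fderiv one_ne_zero).clm_apply continuous_const).clm_apply continuous_const
  rw [integral_finsetSum, integral_finsetSum, integral_finsetSum, ← Finset.sum_add_distrib]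
  · refine Finset.sum_congr rfl fun k _ => ?_
    rw [integral_sq_fderiv_mul_apply hf hη hc, integral_neg]
  · exact fun k _ => ((hf1.continuous.pow 2).mul ((cη' k).pow 2)).integrable_of_hasCompactSupport
      ((hc.fderiv_apply ℝ (EuclideanSpace.single k 1)).mono fun x hx h0 => hx (by simp [h0]))
  · exact fun k _ => ((cD2 k).mul
      (hf1.continuous.mul (hη.continuous.pow 2))).neg.integrable_of_hasCompactSupport
      (hc.mono fun x hx h0 => hx (by simp [h0]))
  · exact fun k _ => ((cD k).pow 2).integrable_of_hasCompactSupport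
      ((hcf.fderiv_apply ℝ (EuclideanSpace.single k 1)).mono fun x hx h0 => hx (by simp [h0]))

lemma rpow_sub_one_mul_sq {p a : ℝ} (hp : 1 < p) (ha : 0 ≤ a) :
    a ^ (p - 1) * a ^ 2 = a ^ (p + 1) := by
  rw [show p + 1 = p - 1 + (2 : ℕ) by push_cast; ring,
    Real.rpow_add_natCast' ha (by push_cast; linarith)]

lemma rpow_sub_three_mul_pow_four {p a : ℝ} (hp : 1 < p) (ha : 0 ≤ a) :
    a ^ (p - 3) * a ^ 4 = a ^ (p + 1) := by
  rw [show p + 1 = p - 3 + (4 : ℕ) by push_cast; ring,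
    Real.rpow_add_natCast' ha (by push_cast; linarith)]

section Energy

variable {n m : ℕ} {p : ℝ} {u : Euc n → EuclideanSpace ℝ (Fin m)} {η : Euc n → ℝ}

lemma integrable_norm_rpow_mul_sq (hp : 1 < p) (hu : Continuous u) (hη : Continuous η)
    (hc : HasCompactSupport η) : Integrable fun x => ‖u x‖ ^ (p + 1) * η x ^ 2 :=
  ((hu.norm.rpow_const fun x => Or.inr (by linarith)).mul
    (hη.pow 2)).integrable_of_hasCompactSupport (hc.mono fun x hx h0 => hx (by simp [h0]))

lemma integrable_mul_norm_fderiv_sq {w : Euc n → ℝ} (hw : Continuous w) (hη : ContDiff ℝ 1 η)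
    (hc : HasCompactSupport η) : Integrable fun x => w x * ‖fderiv ℝ η x‖ ^ 2 :=
  (hw.mul ((hη.continuous_fderiv one_ne_zero).norm.pow 2)).integrable_of_hasCompactSupport
    ((hc.fderiv ℝ).mono fun x hx h0 => hx (by simp [h0]))

/-- The equation tested with `u η²`. -/
lemma sum_integral_norm_fderiv_mul_sq (hp : 1 < p) (hreg : ContDiff ℝ 2 u)
    (hsol : ∀ (i : Fin m) (x : Euc n), -lap (fun z => u z i) x = ‖u x‖ ^ (p - 1) * u x i)
    (hη : ContDiff ℝ 1 η) (hc : HasCompactSupport η) :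
    ∑ i, ∫ x, ‖fderiv ℝ (fun y => u y i * η y) x‖ ^ 2 =
      (∫ x, ‖u x‖ ^ (p + 1) * η x ^ 2) + ∫ x, ‖u x‖ ^ 2 * ‖fderiv ℝ η x‖ ^ 2 := by
  have hui : ∀ i, ContDiff ℝ 2 fun x => u x i := contDiff_euclidean.1 hreg
  have hw : Continuous fun x => ‖u x‖ ^ (p - 1) :=
    hreg.continuous.norm.rpow_const fun x => Or.inr (by linarith)
  simp only [fun i => integral_norm_fderiv_mul_sq (hui i) hη hc, hsol, Finset.sum_add_distrib]
  rw [← integral_finsetSum, ← integral_finsetSum]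
  · congr 1 <;> refine integral_congr_ae (Eventually.of_forall fun x => ?_)
    · simp only [← Finset.sum_mul]
      rw [← rpow_sub_one_mul_sq hp (norm_nonneg _), EuclideanSpace.real_norm_sq_eq, Finset.mul_sum]
      congr 1
      exact Finset.sum_congr rfl fun i _ => by ring
    · simp only [← Finset.sum_mul, EuclideanSpace.real_norm_sq_eq]
  · exact fun i _ => integrable_mul_norm_fderiv_sq ((hui i).continuous.pow 2) hη hc
  · exact fun i _ => (((hw.mul (hui i).continuous).mul (hui i).continuous).mul
      (hη.continuous.pow 2)).integrable_of_hasCompactSupport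
      (hc.mono fun x hx h0 => hx (by simp [h0]))

/-- Stability tested with `u η`, combined with the equation tested with `u η²`. -/
lemma Stable1.sub_one_mul_integral_le (hp : 1 < p) (hreg : ContDiff ℝ 2 u)
    (hsol : ∀ (i : Fin m) (x : Euc n), -lap (fun z => u z i) x = ‖u x‖ ^ (p - 1) * u x i)
    (hstab : Stable1 n m p u Set.univ) (hη : ContDiff ℝ 1 η) (hc : HasCompactSupport η) :
    (p - 1) * ∫ x, ‖u x‖ ^ (p + 1) * η x ^ 2 ≤ ∫ x, ‖u x‖ ^ 2 * ‖fderiv ℝ η x‖ ^ 2 := by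
  have hui : ∀ i, ContDiff ℝ 2 fun x => u x i := contDiff_euclidean.1 hreg
  have hw : Continuous fun x => ‖u x‖ ^ (p - 1) :=
    hreg.continuous.norm.rpow_const fun x => Or.inr (by linarith)
  have key := hstab.of_contDiff_one hp hreg.continuous (φ := fun i x => u x i * η x)
    (fun i => ((hui i).of_le one_le_two).mul hη) fun i => hc.mul_left
  rw [sum_integral_norm_fderiv_mul_sq hp hreg hsol hη hc] at key
  have e₁ : ∑ i, ∫ x, ‖u x‖ ^ (p - 1) * (u x i * η x) ^ 2 =
      ∫ x, ‖u x‖ ^ (p + 1) * η x ^ 2 := by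
    rw [← integral_finsetSum]
    · refine integral_congr_ae (Eventually.of_forall fun x => ?_)
      simp only [mul_pow, ← Finset.mul_sum, ← Finset.sum_mul]
      rw [← EuclideanSpace.real_norm_sq_eq, ← mul_assoc, rpow_sub_one_mul_sq hp (norm_nonneg _)]
    · exact fun i _ => (hw.mul (((hui i).continuous.mul
        hη.continuous).pow 2)).integrable_of_hasCompactSupport
        (hc.mono fun x hx h0 => hx (by simp [h0]))
  have hint : ∀ i j, Integrable fun x =>
      ‖u x‖ ^ (p - 3) * u x i * u x j * (u x i * η x) * (u x j * η x) := by
    intro i j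
    have hL : LocallyIntegrable (fun x => ‖u x‖ ^ (p - 3) * u x i * u x j) volume := by
      refine hw.locallyIntegrable.mono ?_ (Eventually.of_forall fun x => ?_)
      · exact (((hreg.continuous.norm.measurable.pow_const _).mul
          (hui i).continuous.measurable).mul (hui j).continuous.measurable).aestronglyMeasurable
      · exact (abs_rpow_sub_mul_coord_mul_coord_le p (u x) i j).trans (le_abs_self _)
    have := hL.integrable_smul_right_of_hasCompactSupport
      (g := fun x => (u x i * η x) * (u x j * η x))
      (((hui i).continuous.mul hη.continuous).mul ((hui j).continuous.mul hη.continuous))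
      (hc.mono fun x hx h0 => hx (by simp [h0]))
    simpa only [smul_eq_mul, mul_assoc] using this
  have e₂ : ∑ i, ∑ j, ∫ x, ‖u x‖ ^ (p - 3) * u x i * u x j * (u x i * η x) * (u x j * η x) =
      ∫ x, ‖u x‖ ^ (p + 1) * η x ^ 2 := by
    simp_rw [← integral_finsetSum Finset.univ fun j _ => hint _ j]
    rw [← integral_finsetSum _ fun i _ => integrable_finsetSum _ fun j _ => hint i j]
    refine integral_congr_ae (Eventually.of_forall fun x => ?_)
    have e : ‖u x‖ ^ 4 = (∑ i, u x i ^ 2) * ∑ j, u x j ^ 2 := by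
      rw [← EuclideanSpace.real_norm_sq_eq]; ring
    simp only
    rw [← rpow_sub_three_mul_pow_four hp (norm_nonneg _), e, Finset.sum_mul_sum]
    simp only [Finset.mul_sum, Finset.sum_mul]
    exact Finset.sum_congr rfl fun i _ => Finset.sum_congr rfl fun j _ => by ring
  rw [e₁, e₂] at key
  linarith

lemma sum_integral_norm_fderiv_sq_mul_le (hp : 1 < p) (hreg : ContDiff ℝ 2 u)
    (hsol : ∀ (i : Fin m) (x : Euc n), -lap (fun z => u z i) x = ‖u x‖ ^ (p - 1) * u x i)
    (hη : ContDiff ℝ 1 η) (hc : HasCompactSupport η) :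
    ∑ i, ∫ x, ‖fderiv ℝ (fun z => u z i) x‖ ^ 2 * η x ^ 2 ≤
      2 * (∫ x, ‖u x‖ ^ (p + 1) * η x ^ 2) + 4 * ∫ x, ‖u x‖ ^ 2 * ‖fderiv ℝ η x‖ ^ 2 := by
  have hui : ∀ i, ContDiff ℝ 2 fun x => u x i := contDiff_euclidean.1 hreg
  have hui1 : ∀ i, ContDiff ℝ 1 fun x => u x i := fun i => (hui i).of_le one_le_two
  have hIu : ∀ i, Integrable fun x => u x i ^ 2 * ‖fderiv ℝ η x‖ ^ 2 := fun i =>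
    integrable_mul_norm_fderiv_sq ((hui i).continuous.pow 2) hη hc
  have hID : ∀ i, Integrable fun x => ‖fderiv ℝ (fun y => u y i * η y) x‖ ^ 2 := fun i => by
    simpa only [one_mul] using integrable_mul_norm_fderiv_sq (w := fun _ => (1 : ℝ))
      continuous_const ((hui1 i).mul hη) (hc.mul_left (f := fun y => u y i))
  have h : ∀ i, ∫ x, ‖fderiv ℝ (fun z => u z i) x‖ ^ 2 * η x ^ 2 ≤
      2 * (∫ x, ‖fderiv ℝ (fun y => u y i * η y) x‖ ^ 2) +
        2 * ∫ x, u x i ^ 2 * ‖fderiv ℝ η x‖ ^ 2 := by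
    intro i
    rw [← integral_const_mul, ← integral_const_mul,
      ← integral_add ((hID i).const_mul 2) ((hIu i).const_mul 2)]
    refine integral_mono ?_ (((hID i).const_mul 2).add ((hIu i).const_mul 2)) fun x => ?_
    · exact ((((hui1 i).continuous_fderiv one_ne_zero).norm.pow 2).mul
        (hη.continuous.pow 2)).integrable_of_hasCompactSupport
        (hc.mono fun x hx h0 => hx (by simp [h0]))
    · have e : fderiv ℝ (fun y => u y i * η y) x = _ :=
        (((hui1 i).differentiable one_ne_zero x).hasFDerivAt.mul
          (hη.differentiable one_ne_zero x).hasFDerivAt).fderiv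
      have h1 : ‖η x • fderiv ℝ (fun z => u z i) x‖ ≤
          ‖fderiv ℝ (fun y => u y i * η y) x‖ + ‖u x i • fderiv ℝ η x‖ := by
        rw [e]
        exact norm_le_add_norm_add' _ _
      rw [norm_smul, norm_smul, Real.norm_eq_abs, Real.norm_eq_abs] at h1
      have h2 := pow_le_pow_left₀ (by positivity) h1 2
      simp only
      have h3 : ‖fderiv ℝ (fun z => u z i) x‖ ^ 2 * η x ^ 2 =
          (|η x| * ‖fderiv ℝ (fun z => u z i) x‖) ^ 2 := by rw [mul_pow, sq_abs]; ring
      have h4 : u x i ^ 2 * ‖fderiv ℝ η x‖ ^ 2 = (|u x i| * ‖fderiv ℝ η x‖) ^ 2 := by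
        rw [mul_pow, sq_abs]
      rw [h3, h4]
      nlinarith [sq_nonneg (‖fderiv ℝ (fun y => u y i * η y) x‖ - |u x i| * ‖fderiv ℝ η x‖)]
  refine (Finset.sum_le_sum fun i _ => h i).trans ?_
  rw [Finset.sum_add_distrib, ← Finset.mul_sum, ← Finset.mul_sum,
    sum_integral_norm_fderiv_mul_sq hp hreg hsol hη hc, ← integral_finsetSum _ fun i _ => hIu i]
  have e : (∫ x, ∑ i, u x i ^ 2 * ‖fderiv ℝ η x‖ ^ 2) = ∫ x, ‖u x‖ ^ 2 * ‖fderiv ℝ η x‖ ^ 2 := by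
    simp only [← Finset.sum_mul, EuclideanSpace.real_norm_sq_eq]
  rw [e]
  linarith

end Energy

/-- Young's inequality with a small parameter, for powers of a cut-off function. -/
lemma exists_sq_mul_sq_le_of_young {p δ : ℝ} (hp : 1 < p) (hδ : 0 < δ) {k : ℕ}
    (hk : (p + 1) / (p - 1) ≤ k) :
    ∃ C : ℝ, 0 ≤ C ∧ ∀ a s t : ℝ, 0 ≤ a → 0 ≤ s → s ≤ 1 → 0 ≤ t →
      a ^ 2 * (k * s ^ (k - 1) * t) ^ 2 ≤
        δ * (a ^ (p + 1) * (s ^ k) ^ 2) + C * t ^ (2 * (p + 1) / (p - 1)) := by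
  have hp1 : 0 < p - 1 := by linarith
  set r : ℝ := (p + 1) / 2 with hr
  set q : ℝ := (p + 1) / (p - 1) with hq
  have hr0 : 0 < r := by positivity
  have hq1 : 1 < q := by rw [hq, one_lt_div hp1]; linarith
  have hq0 : 0 < q := by linarith
  have hrq : r.HolderConjugate q := by
    rw [Real.holderConjugate_iff]
    refine ⟨by rw [hr]; linarith, ?_⟩
    rw [hr, hq]
    field_simp
    ring
  set ε : ℝ := (δ * r) ^ r⁻¹ with hε
  have hε0 : 0 < ε := by positivity
  have hεr : ε ^ r = δ * r := Real.rpow_inv_rpow (by positivity) hr0.ne'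
  have hk1 : 1 < (k : ℝ) := hq1.trans_le hk
  have hkn : 1 ≤ k := by exact_mod_cast hk1.le
  refine ⟨(k ^ 2 / ε) ^ q / q, by positivity, fun a s t ha hs hs1 ht => ?_⟩
  have hy := Real.young_inequality_of_nonneg (a := ε * (a ^ 2 * (s ^ (k - 1)) ^ 2))
    (b := k ^ 2 / ε * t ^ 2) (by positivity) (by positivity) hrq
  have e₀ : a ^ 2 * (k * s ^ (k - 1) * t) ^ 2 =
      ε * (a ^ 2 * (s ^ (k - 1)) ^ 2) * (k ^ 2 / ε * t ^ 2) := by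
    field_simp
  have e₁ : (a ^ 2 : ℝ) ^ r = a ^ (p + 1) := by
    rw [← Real.rpow_natCast, ← Real.rpow_mul ha]
    congr 1
    rw [hr]; push_cast; ring
  have e₂ : (t ^ 2 : ℝ) ^ q = t ^ (2 * (p + 1) / (p - 1)) := by
    rw [← Real.rpow_natCast, ← Real.rpow_mul ht]
    congr 1
    rw [hq]; push_cast; ring
  have e₃ : (((s ^ (k - 1)) ^ 2 : ℝ)) ^ r ≤ (s ^ k) ^ 2 := by
    rw [← pow_mul, ← pow_mul, ← Real.rpow_natCast, ← Real.rpow_natCast, ← Real.rpow_mul hs]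
    refine Real.rpow_le_rpow_of_exponent_ge_of_imp hs hs1 ?_ fun _ h => ?_
    · push_cast [hkn]
      rw [hq, div_le_iff₀ hp1] at hk
      rw [hr]
      nlinarith
    · have : (0 : ℝ) < ((k - 1) * 2 : ℕ) := by push_cast [hkn]; linarith
      exact absurd h (by positivity)
  rw [e₀]
  refine hy.trans ?_
  rw [Real.mul_rpow hε0.le (by positivity), Real.mul_rpow (by positivity) (by positivity),
    Real.mul_rpow (by positivity) (by positivity), e₁, e₂, hεr]
  have e₄ : δ * r * (a ^ (p + 1) * ((s ^ (k - 1)) ^ 2) ^ r) / r =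
      δ * (a ^ (p + 1) * ((s ^ (k - 1)) ^ 2) ^ r) := by field_simp
  rw [e₄, div_mul_eq_mul_div]
  gcongr

/-- Localised a priori estimate with a general cut-off function. -/
lemma Stable1.exists_integral_le {n m : ℕ} {p : ℝ} {u : Euc n → EuclideanSpace ℝ (Fin m)}
    (hp : 1 < p) (hreg : ContDiff ℝ 2 u)
    (hsol : ∀ (i : Fin m) (x : Euc n), -lap (fun z => u z i) x = ‖u x‖ ^ (p - 1) * u x i)
    (hstab : Stable1 n m p u Set.univ) :
    ∃ (k : ℕ) (C : ℝ), 0 ≤ C ∧ ∀ ψ : Euc n → ℝ, ContDiff ℝ 1 ψ → HasCompactSupport ψ →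
      (∀ x, 0 ≤ ψ x) → (∀ x, ψ x ≤ 1) →
      HasCompactSupport (fun x => ψ x ^ k) ∧
      (∫ x, ‖u x‖ ^ (p + 1) * (ψ x ^ k) ^ 2) ≤
        C * ∫ x, ‖fderiv ℝ ψ x‖ ^ (2 * (p + 1) / (p - 1)) ∧
      (∑ i, ∫ x, ‖fderiv ℝ (fun z => u z i) x‖ ^ 2 * (ψ x ^ k) ^ 2) ≤
        C * ∫ x, ‖fderiv ℝ ψ x‖ ^ (2 * (p + 1) / (p - 1)) := by
  have hp1 : 0 < p - 1 := by linarith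
  obtain ⟨k, hk⟩ := exists_nat_ge ((p + 1) / (p - 1))
  have hk0 : k ≠ 0 := by
    have : 0 < (k : ℝ) := lt_of_lt_of_le (by positivity) hk
    exact_mod_cast this.ne'
  obtain ⟨C, hC, hyoung⟩ := exists_sq_mul_sq_le_of_young hp (half_pos hp1) hk
  refine ⟨k, 2 * (2 * C / (p - 1)) + 4 * (2 * C), by positivity,
    fun ψ hψ hc h0 h1 => ?_⟩
  set s : ℝ := 2 * (p + 1) / (p - 1) with hs
  have hs0 : 0 < s := by positivity
  have hη : ContDiff ℝ 1 fun x => ψ x ^ k := hψ.pow k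
  have hcη : HasCompactSupport fun x => ψ x ^ k := hc.mono fun x hx h => hx (by simp [h, hk0])
  have hst := hstab.sub_one_mul_integral_le hp hreg hsol hη hcη
  have hgr := sum_integral_norm_fderiv_sq_mul_le hp hreg hsol hη hcη
  have hIP := integrable_norm_rpow_mul_sq hp hreg.continuous hη.continuous hcη
  have hIQ := integrable_mul_norm_fderiv_sq (hreg.continuous.norm.pow 2) hη hcη
  have hIT : Integrable fun x => ‖fderiv ℝ ψ x‖ ^ s :=
    ((hψ.continuous_fderiv one_ne_zero).norm.rpow_const
      fun x => Or.inr hs0.le).integrable_of_hasCompactSupport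
      ((hc.fderiv ℝ).mono fun x hx h => hx (by simp [h, hs0.ne']))
  have hQ : ∫ x, ‖u x‖ ^ 2 * ‖fderiv ℝ (fun x => ψ x ^ k) x‖ ^ 2 ≤
      (p - 1) / 2 * (∫ x, ‖u x‖ ^ (p + 1) * (ψ x ^ k) ^ 2) +
        C * ∫ x, ‖fderiv ℝ ψ x‖ ^ s := by
    rw [← integral_const_mul, ← integral_const_mul,
      ← integral_add (hIP.const_mul _) (hIT.const_mul _)]
    refine integral_mono hIQ ((hIP.const_mul _).add (hIT.const_mul _)) fun x => ?_
    have e : fderiv ℝ (fun x => ψ x ^ k) x = _ :=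
      ((hψ.differentiable one_ne_zero x).hasFDerivAt.pow k).fderiv
    have := hyoung ‖u x‖ (ψ x) ‖fderiv ℝ ψ x‖ (norm_nonneg _) (h0 x) (h1 x) (norm_nonneg _)
    have e' : ‖fderiv ℝ (fun x => ψ x ^ k) x‖ = k * ψ x ^ (k - 1) * ‖fderiv ℝ ψ x‖ := by
      rw [e, norm_smul, Real.norm_of_nonneg (by have := h0 x; positivity)]
      simp
    simp only [e']
    exact this
  set P := ∫ x, ‖u x‖ ^ (p + 1) * (ψ x ^ k) ^ 2
  set Q := ∫ x, ‖u x‖ ^ 2 * ‖fderiv ℝ (fun x => ψ x ^ k) x‖ ^ 2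
  set T := ∫ x, ‖fderiv ℝ ψ x‖ ^ s
  have hT : 0 ≤ T := integral_nonneg fun x => by positivity
  have hP : P ≤ 2 * C / (p - 1) * T := by
    rw [div_mul_eq_mul_div, le_div_iff₀ hp1]
    linarith
  have hQ' : Q ≤ 2 * C * T := by linarith
  have : 0 ≤ C * T := by positivity
  have : 0 ≤ 2 * C / (p - 1) * T := by positivity
  exact ⟨hcη, by linarith, by linarith⟩

lemma integral_norm_fderiv_comp_inv_smul_rpow {n : ℕ} (χ : Euc n → ℝ)
    {R : ℝ} (hR : 0 < R) (s : ℝ) :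
    ∫ x, ‖fderiv ℝ (fun y => χ (R⁻¹ • y)) x‖ ^ s =
      R ^ ((n : ℝ) - s) * ∫ x, ‖fderiv ℝ χ x‖ ^ s := by
  have h : ∀ x, ‖fderiv ℝ (fun y => χ (R⁻¹ • y)) x‖ ^ s =
      R ^ (-s) * ‖fderiv ℝ χ (R⁻¹ • x)‖ ^ s := by
    intro x
    rw [fderiv_comp_smul, norm_smul, Real.norm_of_nonneg (by positivity),
      Real.mul_rpow (by positivity) (norm_nonneg _), Real.inv_rpow hR.le, Real.rpow_neg hR.le]
  simp only [h]
  rw [integral_const_mul, Measure.integral_comp_inv_smul volume (fun x => ‖fderiv ℝ χ x‖ ^ s) R,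
    finrank_euclideanSpace_fin, abs_of_pos (by positivity), smul_eq_mul, ← mul_assoc,
    sub_eq_neg_add, Real.rpow_add hR, Real.rpow_natCast]

lemma setIntegral_le_integral_mul_of_eq_one {n : ℕ} {f η : Euc n → ℝ} {s : Set (Euc n)}
    (hs : MeasurableSet s) (hf : Continuous f) (hf0 : ∀ x, 0 ≤ f x) (hη : Continuous η)
    (hc : HasCompactSupport η) (h1 : ∀ x ∈ s, η x = 1) :
    ∫ x in s, f x ≤ ∫ x, f x * η x ^ 2 := by
  have e : ∫ x in s, f x = ∫ x in s, f x * η x ^ 2 :=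
    setIntegral_congr_fun hs fun x hx => by simp [h1 x hx]
  rw [e]
  refine setIntegral_le_integral ?_ (Eventually.of_forall fun x => ?_)
  · exact (hf.mul (hη.pow 2)).integrable_of_hasCompactSupport
      (hc.mono fun x hx h0 => hx (by simp [h0]))
  · exact mul_nonneg (hf0 x) (sq_nonneg _)

/-- Lemma 2.2: a priori estimates for stable solutions of `−Δu_i = |u|^{p−1} u_i`:
`∫_{B_R} |u|^{p+1} ≤ C R^{n−2(p+1)/(p−1)}` and
`Σ_i ∫_{B_R} |∇u_i|² ≤ C R^{n−2(p+1)/(p−1)}` for every `R > 1`. -/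
theorem statement6 (n m : ℕ) (hn : 1 ≤ n) (hm : 1 ≤ m) (p : ℝ) (hp : 1 < p)
    (u : Euc n → EuclideanSpace ℝ (Fin m)) (hreg : ContDiff ℝ 2 u)
    (hsol : ∀ (i : Fin m) (x : Euc n), - lap (fun z => u z i) x = ‖u x‖ ^ (p - 1) * u x i)
    (hstab : Stable1 n m p u Set.univ) :
    ∃ C : ℝ, 0 < C ∧ ∀ R : ℝ, 1 < R →
      (∫ x in ball (0 : Euc n) R, ‖u x‖ ^ (p + 1))
          ≤ C * R ^ ((n : ℝ) - 2 * (p + 1) / (p - 1)) ∧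
      (∑ i, ∫ x in ball (0 : Euc n) R, ‖gradient (fun z => u z i) x‖ ^ 2)
          ≤ C * R ^ ((n : ℝ) - 2 * (p + 1) / (p - 1)) := by
  obtain ⟨k, C, hC, hmain⟩ := hstab.exists_integral_le hp hreg hsol
  let χ : ContDiffBump (0 : Euc n) := ⟨1, 2, one_pos, one_lt_two⟩
  set s : ℝ := 2 * (p + 1) / (p - 1) with hs
  have hχ : ContDiff ℝ 1 χ := χ.contDiff
  have hT : 0 ≤ ∫ x, ‖fderiv ℝ χ x‖ ^ s := integral_nonneg fun x => by positivity
  refine ⟨C * (∫ x, ‖fderiv ℝ χ x‖ ^ s) + 1, by positivity, fun R hR => ?_⟩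
  have hR0 : 0 < R := by linarith
  have hψ : ContDiff ℝ 1 fun x => χ (R⁻¹ • x) := hχ.comp (contDiff_const_smul _)
  have hcψ : HasCompactSupport fun x => χ (R⁻¹ • x) :=
    χ.hasCompactSupport.comp_smul (inv_ne_zero hR0.ne')
  obtain ⟨hcη, h₁, h₂⟩ := hmain _ hψ hcψ (fun x => χ.nonneg) fun x => χ.le_one
  rw [integral_norm_fderiv_comp_inv_smul_rpow χ hR0] at h₁ h₂
  have hη : Continuous fun x => χ (R⁻¹ • x) ^ k := hψ.continuous.pow k
  have hone : ∀ x ∈ ball (0 : Euc n) R, χ (R⁻¹ • x) ^ k = 1 := by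
    intro x hx
    rw [mem_ball_zero_iff] at hx
    rw [χ.one_of_mem_closedBall, one_pow]
    rw [mem_closedBall_zero_iff, norm_smul, norm_inv, Real.norm_of_nonneg hR0.le,
      inv_mul_le_iff₀ hR0]
    change ‖x‖ ≤ R * 1
    linarith
  have hle : C * (R ^ ((n : ℝ) - s) * ∫ x, ‖fderiv ℝ χ x‖ ^ s) ≤
      (C * (∫ x, ‖fderiv ℝ χ x‖ ^ s) + 1) * R ^ ((n : ℝ) - s) := by
    have : 0 ≤ R ^ ((n : ℝ) - s) := by positivity
    linarith
  have hu1 : ∀ i, ContDiff ℝ 1 fun x => u x i := fun i =>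
    (contDiff_euclidean.1 hreg i).of_le one_le_two
  constructor
  · refine le_trans ?_ (h₁.trans hle)
    exact setIntegral_le_integral_mul_of_eq_one measurableSet_ball
      (hreg.continuous.norm.rpow_const fun x => Or.inr (by linarith))
      (fun x => by positivity) hη hcη hone
  · refine le_trans (Finset.sum_le_sum fun i _ => ?_) (h₂.trans hle)
    simp only [norm_gradient_eq]
    exact setIntegral_le_integral_mul_of_eq_one measurableSet_ball
      (((hu1 i).continuous_fderiv one_ne_zero).norm.pow 2) (fun x => by positivity) hη hcη hone
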